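/- Let ε ≥ 0 and T > 0. Suppose H ∈ C([0,T]; C²(T×ℝ⁺)) ∩ C¹([0,T]; C⁰(T×ℝ⁺)) is a bounded function satisfying the differential inequality (∂_t + b₁∂_x + b₂∂_y − ε²∂_x² − ∂_y²) H ≤ f H on [0,T]×T×ℝ⁺, where the coefficients b₁, b₂, f are continuous, ‖b₂/(1+y)‖_{L^∞([0,T]×T×ℝ⁺)} < ∞, and ‖f‖_{L^∞([0,T]×T×ℝ⁺)} ≤ λ. Then for any t ∈ [0,T], sup_{T×ℝ⁺} H(t) ≤ max { e^{λt} ‖H(0)‖_{L^∞(T×ℝ⁺)}, max_{τ∈[0,t]} e^{λ(t−τ)} ‖H(τ)|_{y=0}‖_{L^∞(T)} }. -/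

import Mathlib

open MeasureTheory Real Set Filter Topology

noncomputable section

/-- partial derivative in the first (tangential, `x`) variable -/
def px (f : ℝ → ℝ → ℝ) : ℝ → ℝ → ℝ := fun x y => deriv (fun x' => f x' y) x

/-- partial derivative in the second (normal, `y`) variable -/
def py (f : ℝ → ℝ → ℝ) : ℝ → ℝ → ℝ := fun x y => deriv (fun y' => f x y') y

/-- `D^α = ∂ₓ^{α₁} ∂_y^{α₂}` for a multi-index `α = (α₁, α₂)` -/
def DD (a : ℕ × ℕ) (f : ℝ → ℝ → ℝ) : ℝ → ℝ → ℝ := px^[a.1] (py^[a.2] f)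

/-- multiplication by the weight `(1+y)^r` -/
def wt (r : ℝ) (f : ℝ → ℝ → ℝ) : ℝ → ℝ → ℝ := fun x y => (1 + y) ^ r * f x y

/-- squared `L²` norm on `𝕋 × ℝ⁺` (the `x` variable runs over one period) -/
def L2sq (f : ℝ → ℝ → ℝ) : ℝ := ∫ x in Ioc (0:ℝ) 1, ∫ y in Ioi (0:ℝ), (f x y) ^ 2

/-- `L²` norm on `𝕋 × ℝ⁺` -/
def L2 (f : ℝ → ℝ → ℝ) : ℝ := Real.sqrt (L2sq f)

/-- sup (`L^∞`) norm on `𝕋 × ℝ⁺` -/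
def Linf (f : ℝ → ℝ → ℝ) : ℝ := sSup {r : ℝ | ∃ x y, 0 ≤ y ∧ r = |f x y|}

/-- squared `L²` norm on the circle `𝕋` -/
def L2Tsq (g : ℝ → ℝ) : ℝ := ∫ x in Ioc (0:ℝ) 1, (g x) ^ 2

/-- `L²` norm on the circle `𝕋` -/
def L2T (g : ℝ → ℝ) : ℝ := Real.sqrt (L2Tsq g)

/-- sup (`L^∞`) norm on the circle `𝕋` -/
def LinfT (g : ℝ → ℝ) : ℝ := sSup {r : ℝ | ∃ x, r = |g x|}

/-- squared `H^k` norm on the circle `𝕋` -/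
def HkTsq (k : ℕ) (g : ℝ → ℝ) : ℝ :=
  ∑ j ∈ Finset.range (k + 1), ∫ x in Ioc (0:ℝ) 1, (iteratedDeriv j g x) ^ 2

/-- multi-indices `α` with `|α| ≤ s` -/
def idxLe (s : ℕ) : Finset (ℕ × ℕ) :=
  (Finset.range (s + 1) ×ˢ Finset.range (s + 1)).filter fun a => a.1 + a.2 ≤ s

/-- squared weighted Sobolev norm `‖w‖²_{H^{s,γ}}` -/
def HsGsq (s : ℕ) (γ : ℝ) (w : ℝ → ℝ → ℝ) : ℝ :=
  ∑ a ∈ idxLe s, L2sq (wt (γ + (a.2 : ℝ)) (DD a w))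

/-- the quantity `Q = Σ_{1 ≤ |α| ≤ 2} ‖(1+y)^{σ+α₂} D^α w‖²_{L^∞}` -/
def Qsq (σ : ℝ) (w : ℝ → ℝ → ℝ) : ℝ :=
  ∑ a ∈ (idxLe 2).filter (fun a => 1 ≤ a.1 + a.2),
    (Linf (wt (σ + (a.2 : ℝ)) (DD a w))) ^ 2

/-- squared norm `‖w‖²_{B^{s,γ,σ}}` -/
def Bsq (s : ℕ) (γ σ : ℝ) (w : ℝ → ℝ → ℝ) : ℝ := HsGsq s γ w + Qsq σ w

/-- the horizontal velocity recovered from the vorticity: `u = U - ∫_y^∞ w dη` -/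
def uVel (U : ℝ → ℝ) (w : ℝ → ℝ → ℝ) : ℝ → ℝ → ℝ :=
  fun x y => U x - ∫ η in Ioi y, w x η

/-- the vertical velocity: `v = -∫_0^y ∂ₓ u dη` -/
def vVel (U : ℝ → ℝ) (w : ℝ → ℝ → ℝ) : ℝ → ℝ → ℝ :=
  fun x y => - ∫ η in Ioc (0:ℝ) y, px (uVel U w) x η

/-- the good unknown `g_k = ∂ₓ^k w - (∂_y w / w) ∂ₓ^k (u - U)` -/
def gFun (k : ℕ) (U : ℝ → ℝ) (w : ℝ → ℝ → ℝ) : ℝ → ℝ → ℝ :=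
  fun x y => px^[k] w x y
    - (py w x y / w x y) * px^[k] (fun x' y' => uVel U w x' y' - U x') x y

/-- squared norm `‖w‖²_{H^{s,γ}_g}` -/
def HsGgsq (s : ℕ) (γ : ℝ) (U : ℝ → ℝ) (w : ℝ → ℝ → ℝ) : ℝ :=
  L2sq (wt γ (gFun s U w))
    + ∑ a ∈ (idxLe s).filter (fun a => a.1 < s), L2sq (wt (γ + (a.2 : ℝ)) (DD a w))

/-- squared norm `‖w‖²_{B^{s,γ,σ}_g}` -/
def Bgsq (s : ℕ) (γ σ : ℝ) (U : ℝ → ℝ) (w : ℝ → ℝ → ℝ) : ℝ :=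
  HsGgsq s γ U w + Qsq σ w

/-- `k`-th time derivative of a time dependent function on the circle -/
def dtk (k : ℕ) (U : ℝ → ℝ → ℝ) : ℝ → ℝ → ℝ :=
  fun t x => iteratedDeriv k (fun t' => U t' x) t

/-- `M_U = Σ_{k=0}^{s/2+1} sup_{0 ≤ t ≤ T} ‖∂ₜ^k U(t)‖²_{H^{s-2k+2}(𝕋)}` -/
def MU (s : ℕ) (T : ℝ) (U : ℝ → ℝ → ℝ) : ℝ :=
  ∑ k ∈ Finset.range (s / 2 + 2),
    sSup {r : ℝ | ∃ t ∈ Icc (0:ℝ) T, r = HkTsq (s + 2 - 2 * k) (dtk k U t)}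

/-- amalgamated outer flow `U(x) := ∫_0^∞ w(x,η) dη` of a steady vorticity -/
def Uof (w : ℝ → ℝ → ℝ) : ℝ → ℝ := fun x => ∫ η in Ioi (0:ℝ), w x η

/-- the regularized Prandtl vorticity system on `[0,Tε] × 𝕋 × ℝ⁺` -/
def RegPrandtl (ε : ℝ) (U pe : ℝ → ℝ → ℝ) (w : ℝ → ℝ → ℝ → ℝ)
    (w0 : ℝ → ℝ → ℝ) (Tε : ℝ) : Prop :=
  (∀ t x y, w t (x + 1) y = w t x y) ∧
  (∀ t x, U t (x + 1) = U t x) ∧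
  (∀ t x, pe t (x + 1) = pe t x) ∧
  (∀ t ∈ Icc (0:ℝ) Tε, ∀ (x : ℝ), ∀ y ∈ Ici (0:ℝ),
    deriv (fun t' => w t' x y) t
      + uVel (U t) (w t) x y * px (w t) x y
      + vVel (U t) (w t) x y * py (w t) x y
      = ε ^ 2 * px (px (w t)) x y + py (py (w t)) x y) ∧
  (∀ t ∈ Icc (0:ℝ) Tε, ∀ x : ℝ, py (w t) x 0 = deriv (pe t) x) ∧
  (∀ x y, w 0 x y = w0 x y) ∧
  (∀ t x, deriv (fun t' => U t' x) t + U t x * deriv (U t) x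
      = ε ^ 2 * deriv (deriv (U t)) x - deriv (pe t) x)

/-- smoothness of a time dependent field on `[0,T] × 𝕋 × ℝ⁺` -/
def SmoothOnDom (T : ℝ) (w : ℝ → ℝ → ℝ → ℝ) : Prop :=
  ContDiffOn ℝ (⊤ : ℕ∞) (fun p : ℝ × ℝ × ℝ => w p.1 p.2.1 p.2.2)
    (Icc 0 T ×ˢ (univ : Set ℝ) ×ˢ Ici (0:ℝ))

/-- finiteness of the `B^{s,γ,σ}` norm: square integrability of all the weighted
derivatives up to order `s` together with boundedness of the weighted derivatives
of order `1 ≤ |α| ≤ 2` -/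
def BFinite (s : ℕ) (γ σ : ℝ) (w : ℝ → ℝ → ℝ) : Prop :=
  (∀ a ∈ idxLe s,
    IntegrableOn (fun q : ℝ × ℝ => (wt (γ + (a.2 : ℝ)) (DD a w) q.1 q.2) ^ 2)
      (Ioc (0:ℝ) 1 ×ˢ Ioi (0:ℝ))) ∧
  (∀ a ∈ (idxLe 2).filter (fun a => 1 ≤ a.1 + a.2),
    BddAbove {r : ℝ | ∃ x y, 0 ≤ y ∧ r = |wt (σ + (a.2 : ℝ)) (DD a w) x y|})

/-- classical solution of the (unregularized) Prandtl system on `[0,T] × 𝕋 × ℝ⁺` -/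
def PrandtlSolution (U p : ℝ → ℝ → ℝ) (u0 : ℝ → ℝ → ℝ)
    (u v : ℝ → ℝ → ℝ → ℝ) (T : ℝ) : Prop :=
  (∀ t x y, u t (x + 1) y = u t x y) ∧
  (∀ t x y, v t (x + 1) y = v t x y) ∧
  (∀ t ∈ Icc (0:ℝ) T, ∀ (x : ℝ), ∀ y ∈ Ici (0:ℝ),
    deriv (fun t' => u t' x y) t + u t x y * px (u t) x y + v t x y * py (u t) x y
      - py (py (u t)) x y + deriv (p t) x = 0) ∧
  (∀ t ∈ Icc (0:ℝ) T, ∀ (x : ℝ), ∀ y ∈ Ici (0:ℝ), px (u t) x y + py (v t) x y = 0) ∧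
  (∀ t ∈ Icc (0:ℝ) T, ∀ x : ℝ, u t x 0 = 0 ∧ v t x 0 = 0) ∧
  (∀ t ∈ Icc (0:ℝ) T, ∀ x : ℝ, Tendsto (fun y => u t x y) atTop (nhds (U t x))) ∧
  (∀ x y, u 0 x y = u0 x y)

/-- A function with a left-sided maximum at `a` has nonnegative derivative there. -/
lemma HasDerivAt.nonneg_of_left_max {g : ℝ → ℝ} {g' a : ℝ} (hg : HasDerivAt g g' a)
    (h : ∀ᶠ τ in 𝓝[<] a, g τ ≤ g a) : 0 ≤ g' := by
  have hs : Tendsto (slope g a) (𝓝[<] a) (𝓝 g') :=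
    (hasDerivAt_iff_tendsto_slope.1 hg).mono_left
      (nhdsWithin_mono _ fun z hz => ne_of_lt hz)
  refine ge_of_tendsto hs ?_
  filter_upwards [h, self_mem_nhdsWithin] with τ hτ hlt
  rw [slope_def_field]
  exact div_nonneg_of_nonpos (by linarith) (by linarith [mem_Iio.1 hlt])

/-- Second order necessary condition at a local maximum. -/
lemma IsLocalMax.deriv_deriv_nonpos {g : ℝ → ℝ} {a : ℝ} (h : IsLocalMax g a)
    (hc : ContinuousAt g a) : deriv (deriv g) a ≤ 0 := by
  by_contra! hpos
  have hmin : IsLocalMin g a := isLocalMin_of_deriv_deriv_pos hpos h.deriv_eq_zero hc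
  have heq : g =ᶠ[𝓝 a] fun _ => g a := by
    filter_upwards [h, hmin] with z h1 h2 using le_antisymm h1 h2
  have h2 : deriv (deriv g) a = 0 := by
    rw [heq.deriv.deriv_eq]; simp
  exact hpos.ne' h2

/-- First and second order conditions at a local maximum of a linearly tilted function. -/
lemma deriv_of_isLocalMax_sub_linear {h : ℝ → ℝ} {c a : ℝ}
    (hd : ∀ᶠ y in 𝓝 a, DifferentiableAt ℝ h y)
    (hm : IsLocalMax (fun y => h y - c * y) a) : deriv h a = c ∧ deriv (deriv h) a ≤ 0 := by
  have hderiv : deriv (fun y => h y - c * y) =ᶠ[𝓝 a] fun y => deriv h y - c := by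
    filter_upwards [hd] with y hy
    exact (hy.hasDerivAt.sub (by simpa using (hasDerivAt_id y).const_mul c)).deriv
  constructor
  · have h0 := hm.deriv_eq_zero
    rw [hderiv.eq_of_nhds] at h0
    linarith
  · have h2 := hm.deriv_deriv_nonpos (hd.self_of_nhds.continuousAt.sub (by fun_prop))
    rwa [hderiv.deriv_eq, deriv_sub_const] at h2

/-- A continuous function on `[0,S] × ℝ × [0,∞)`, periodic in the second variable and nonpositive
for large values of the third, attains its maximum as soon as it is positive somewhere. -/
lemma exists_max_of_periodic {Φ : ℝ → ℝ → ℝ → ℝ} {S Y : ℝ}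
    (hc : ContinuousOn (fun q : ℝ × ℝ × ℝ => Φ q.1 q.2.1 q.2.2)
      (Icc 0 S ×ˢ (univ : Set ℝ) ×ˢ Ici (0:ℝ)))
    (hper : ∀ t y, Function.Periodic (fun x => Φ t x y) 1)
    (hY : ∀ t ∈ Icc 0 S, ∀ x y, Y < y → Φ t x y ≤ 0)
    {t₁ x₁ y₁ : ℝ} (ht₁ : t₁ ∈ Icc 0 S) (hy₁ : 0 ≤ y₁) (hpos : 0 < Φ t₁ x₁ y₁) :
    ∃ t₀ ∈ Icc 0 S, ∃ x₀ y₀, 0 ≤ y₀ ∧ 0 < Φ t₀ x₀ y₀ ∧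
      ∀ t ∈ Icc 0 S, ∀ x y, 0 ≤ y → Φ t x y ≤ Φ t₀ x₀ y₀ := by
  have hfr : ∀ t x y, Φ t (Int.fract x) y = Φ t x y := by
    intro t x y
    have := (hper t y).sub_int_mul_eq (x := x) ⌊x⌋
    rwa [mul_one] at this
  have hmem : ∀ x : ℝ, Int.fract x ∈ Icc (0:ℝ) 1 :=
    fun x => ⟨Int.fract_nonneg x, (Int.fract_lt_one x).le⟩
  have hyY : y₁ ≤ Y := by
    by_contra! hlt
    exact absurd (hY t₁ ht₁ x₁ y₁ hlt) (not_le.2 hpos)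
  have hK : IsCompact (Icc 0 S ×ˢ Icc (0:ℝ) 1 ×ˢ Icc 0 Y) :=
    isCompact_Icc.prod (isCompact_Icc.prod isCompact_Icc)
  obtain ⟨⟨t₀, x₀, y₀⟩, ⟨ht₀, -, hy₀⟩, hmax⟩ := hK.exists_isMaxOn
    ⟨(t₁, Int.fract x₁, y₁), ht₁, hmem x₁, hy₁, hyY⟩
    (hc.mono fun q hq => ⟨hq.1, mem_univ _, hq.2.2.1⟩)
  have hle : ∀ t ∈ Icc 0 S, ∀ x y, 0 ≤ y → y ≤ Y → Φ t x y ≤ Φ t₀ x₀ y₀ := by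
    intro t ht x y hy hyY
    rw [← hfr t x y]
    exact hmax (show (t, Int.fract x, y) ∈ _ from ⟨ht, hmem x, hy, hyY⟩)
  have hpos₀ : 0 < Φ t₀ x₀ y₀ := hpos.trans_le (hle t₁ ht₁ x₁ y₁ hy₁ hyY)
  refine ⟨t₀, ht₀, x₀, y₀, hy₀.1, hpos₀, fun t ht x y hy => ?_⟩
  rcases le_or_gt y Y with h | h
  · exact hle t ht x y hy h
  · exact (hY t ht x y h).trans hpos₀.le

/-- Exponential upper bound before the final time, given a bound on the parabolic boundary. -/
lemma le_exp_mul_of_parabolic_boundary_le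
    {ε T lam C : ℝ} {H b₁ b₂ f : ℝ → ℝ → ℝ → ℝ}
    (hreg : ContDiffOn ℝ 2 (fun q : ℝ × ℝ × ℝ => H q.1 q.2.1 q.2.2)
      (Icc 0 T ×ˢ (univ : Set ℝ) ×ˢ Ici (0:ℝ)))
    (hper : ∀ t x y, H t (x + 1) y = H t x y)
    (hbdd : ∃ M, ∀ t ∈ Icc (0:ℝ) T, ∀ (x : ℝ), ∀ y ∈ Ici (0:ℝ), |H t x y| ≤ M)
    (hb2bdd : ∃ M, ∀ t ∈ Icc (0:ℝ) T, ∀ (x : ℝ), ∀ y ∈ Ici (0:ℝ), |b₂ t x y / (1 + y)| ≤ M)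
    (hfbdd : ∀ t ∈ Icc (0:ℝ) T, ∀ (x : ℝ), ∀ y ∈ Ici (0:ℝ), |f t x y| ≤ lam)
    (hineq : ∀ t ∈ Icc (0:ℝ) T, ∀ (x : ℝ), ∀ y ∈ Ici (0:ℝ),
      deriv (fun t' => H t' x y) t + b₁ t x y * px (H t) x y + b₂ t x y * py (H t) x y
        - ε ^ 2 * px (px (H t)) x y - py (py (H t)) x y ≤ f t x y * H t x y)
    {S : ℝ} (hST : S < T) (hC : 0 ≤ C)
    (hinit : ∀ x y, 0 ≤ y → H 0 x y ≤ C)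
    (hbdry : ∀ τ ∈ Icc 0 S, ∀ x, H τ x 0 ≤ exp (lam * τ) * C)
    {s : ℝ} (hs : s ∈ Icc 0 S) (x y : ℝ) (hy : 0 ≤ y) :
    H s x y ≤ exp (lam * s) * C := by
  obtain ⟨M, hM⟩ := hbdd
  obtain ⟨B, hB⟩ := hb2bdd
  have hT0 : (0:ℝ) ∈ Icc 0 T := ⟨le_rfl, by linarith [hs.1, hs.2]⟩
  have hlam : 0 ≤ lam := (abs_nonneg _).trans (hfbdd 0 hT0 0 0 (mem_Ici.2 le_rfl))
  have hB0 : 0 ≤ B := (abs_nonneg _).trans (hB 0 hT0 0 0 (mem_Ici.2 le_rfl))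
  have hM0 : 0 ≤ M := (abs_nonneg _).trans (hM 0 hT0 0 0 (mem_Ici.2 le_rfl))
  have hsub : Icc 0 S ⊆ Icc 0 T := Icc_subset_Icc_right hST.le
  have key : ∀ δ > 0, exp (-(lam * s)) * H s x y - C - δ * (exp ((B + 1) * s) * (1 + y)) ≤ 0 := by
    intro δ hδ
    by_contra! hpos
    obtain ⟨t₀, ht₀, x₀, y₀, hy₀, hpos₀, hmax⟩ := exists_max_of_periodic (S := S) (Y := M / δ)
      (Φ := fun t x y => exp (-(lam * t)) * H t x y - C - δ * (exp ((B + 1) * t) * (1 + y)))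
      (by
        have := hreg.continuousOn.mono
          (prod_mono hsub (Subset.refl ((univ : Set ℝ) ×ˢ Ici (0:ℝ))))
        fun_prop)
      (by intro t y x; simp only [hper])
      (by
        intro t ht x y hy
        have hy0 : 0 ≤ y := (div_nonneg hM0 hδ.le).trans hy.le
        have h1 : exp (-(lam * t)) * H t x y ≤ M := by
          have h2 : exp (-(lam * t)) ≤ 1 := exp_le_one_iff.2 (by nlinarith [ht.1])
          have h3 := hM t (hsub ht) x y hy0
          calc _ ≤ exp (-(lam * t)) * M := by
                gcongr; exact (le_abs_self _).trans h3
            _ ≤ 1 * M := by gcongr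
            _ = M := one_mul M
        have h2 : (1:ℝ) ≤ exp ((B + 1) * t) :=
          one_le_exp (mul_nonneg (by linarith) ht.1)
        have h3 : M < δ * y := by rwa [div_lt_iff₀' hδ] at hy
        have h4 : δ * (1 * y) ≤ δ * (exp ((B + 1) * t) * (1 + y)) := by
          gcongr; linarith
        linarith)
      hs hy hpos
    have ht₀T := hsub ht₀
    have hψ : 0 < δ * (exp ((B + 1) * t₀) * (1 + y₀)) := by positivity
    have ht₀pos : 0 < t₀ := by
      refine lt_of_le_of_ne ht₀.1 fun h => ?_
      subst h
      have := hinit x₀ y₀ hy₀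
      simp only [mul_zero, neg_zero, exp_zero, one_mul] at hpos₀ hψ
      linarith
    have hy₀pos : 0 < y₀ := by
      refine lt_of_le_of_ne hy₀ fun h => ?_
      subst h
      have h1 := mul_le_mul_of_nonneg_left (hbdry t₀ ht₀ x₀) (exp_pos (-(lam * t₀))).le
      rw [← mul_assoc, ← exp_add, neg_add_cancel, exp_zero, one_mul] at h1
      linarith
    have hdiff : ∀ y, 0 < y →
        DifferentiableAt ℝ (fun q : ℝ × ℝ × ℝ => H q.1 q.2.1 q.2.2) (t₀, x₀, y) := by
      intro y hy
      refine (hreg.contDiffAt ?_).differentiableAt (by norm_num)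
      exact prod_mem_nhds (Icc_mem_nhds ht₀pos (ht₀.2.trans_lt hST))
        (prod_mem_nhds univ_mem (Ici_mem_nhds hy))
    have hdt : DifferentiableAt ℝ (fun t => H t x₀ y₀) t₀ :=
      (hdiff y₀ hy₀pos).comp t₀ (f := fun t : ℝ => (t, x₀, y₀)) (by fun_prop)
    have hdx : DifferentiableAt ℝ (fun x => H t₀ x y₀) x₀ :=
      (hdiff y₀ hy₀pos).comp x₀ (f := fun x : ℝ => (t₀, x, y₀)) (by fun_prop)
    have hdy : ∀ y, 0 < y → DifferentiableAt ℝ (fun y => H t₀ x₀ y) y := fun y hy =>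
      (hdiff y hy).comp y (f := fun y : ℝ => (t₀, x₀, y)) (by fun_prop)
    set E := exp (-(lam * t₀)) with hE
    have hEpos : 0 < E := exp_pos _
    set G := exp ((B + 1) * t₀) with hG
    have hGpos : 0 < G := exp_pos _
    have hxmax : IsLocalMax (fun x => H t₀ x y₀) x₀ := Eventually.of_forall fun x => by
      have := hmax t₀ ht₀ x y₀ hy₀
      exact le_of_mul_le_mul_left (by linarith) hEpos
    have hx1 : px (H t₀) x₀ y₀ = 0 := hxmax.deriv_eq_zero
    have hx2 : px (px (H t₀)) x₀ y₀ ≤ 0 := hxmax.deriv_deriv_nonpos hdx.continuousAt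
    have hymax : IsLocalMax (fun y => H t₀ x₀ y - δ * G / E * y) y₀ := by
      filter_upwards [Ioi_mem_nhds hy₀pos] with y hy
      have := hmax t₀ ht₀ x₀ y (le_of_lt hy)
      refine le_of_mul_le_mul_left ?_ hEpos
      have h1 : ∀ z, E * (H t₀ x₀ z - δ * G / E * z) = E * H t₀ x₀ z - δ * (G * z) := by
        intro z; field_simp
      rw [h1, h1]
      linarith
    obtain ⟨hy1, hy2⟩ := deriv_of_isLocalMax_sub_linear
      (by filter_upwards [Ioi_mem_nhds hy₀pos] with y hy using hdy y hy) hymax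
    have ht1 : 0 ≤ (E * -lam) * H t₀ x₀ y₀ + E * deriv (fun t => H t x₀ y₀) t₀
        - δ * ((G * (B + 1)) * (1 + y₀)) := by
      refine HasDerivAt.nonneg_of_left_max (a := t₀)
        (g := fun t => exp (-(lam * t)) * H t x₀ y₀ - C
          - δ * (exp ((B + 1) * t) * (1 + y₀))) ?_ ?_
      · have e1 : HasDerivAt (fun t => exp (-(lam * t))) (E * -lam) t₀ := by
          simpa using ((hasDerivAt_id t₀).const_mul lam).neg.exp
        have e2 : HasDerivAt (fun t => exp ((B + 1) * t)) (G * (B + 1)) t₀ := by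
          simpa using ((hasDerivAt_id t₀).const_mul (B + 1)).exp
        exact ((e1.mul hdt.hasDerivAt).sub_const C).sub ((e2.mul_const (1 + y₀)).const_mul δ)
      · filter_upwards [Ioo_mem_nhdsLT ht₀pos] with τ hτ
        exact hmax τ ⟨hτ.1.le, hτ.2.le.trans ht₀.2⟩ x₀ y₀ hy₀
    have hPDE := hineq t₀ ht₀T x₀ y₀ hy₀
    rw [hx1, show py (H t₀) x₀ y₀ = δ * G / E from hy1] at hPDE
    have hy2' : py (py (H t₀)) x₀ y₀ ≤ 0 := hy2
    have hHpos : 0 < E * H t₀ x₀ y₀ := by linarith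
    have hf := mul_le_mul_of_nonneg_right
      ((le_abs_self _).trans (hfbdd t₀ ht₀T x₀ y₀ hy₀)) hHpos.le
    have hb : -(B * (1 + y₀)) ≤ b₂ t₀ x₀ y₀ := by
      have h1 := neg_le_of_abs_le (hB t₀ ht₀T x₀ y₀ hy₀)
      rw [le_div_iff₀ (by linarith)] at h1
      linarith
    have hb' := mul_le_mul_of_nonneg_right hb (mul_pos hδ hGpos).le
    have hPDE2 : deriv (fun t => H t x₀ y₀) t₀ + b₂ t₀ x₀ y₀ * (δ * G / E)
        ≤ f t₀ x₀ y₀ * H t₀ x₀ y₀ := by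
      nlinarith [mul_nonneg (sq_nonneg ε) (neg_nonneg.2 hx2)]
    have hPDE3 := mul_le_mul_of_nonneg_left hPDE2 hEpos.le
    rw [mul_add, show E * (b₂ t₀ x₀ y₀ * (δ * G / E)) = b₂ t₀ x₀ y₀ * (δ * G) by
      field_simp] at hPDE3
    linarith
  have hlim : Tendsto
      (fun δ : ℝ => exp (-(lam * s)) * H s x y - C - δ * (exp ((B + 1) * s) * (1 + y)))
      (𝓝[>] 0) (𝓝 (exp (-(lam * s)) * H s x y - C)) := by
    have : Continuous
      (fun δ : ℝ => exp (-(lam * s)) * H s x y - C - δ * (exp ((B + 1) * s) * (1 + y))) := by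
      fun_prop
    simpa using (this.tendsto 0).mono_left nhdsWithin_le_nhds
  have hle := le_of_tendsto hlim (by
    filter_upwards [self_mem_nhdsWithin] with δ hδ using key δ hδ)
  have h1 := mul_le_mul_of_nonneg_left (sub_nonpos.1 hle) (exp_pos (lam * s)).le
  rwa [← mul_assoc, ← exp_add, add_neg_cancel, exp_zero, one_mul] at h1

/-- Maximum principle for parabolic equations on `[0,T] × 𝕋 × ℝ⁺`. -/
theorem maximum_principle_parabolic
    (ε T lam : ℝ) (hε : 0 ≤ ε) (hT : 0 < T)
    (H b₁ b₂ f : ℝ → ℝ → ℝ → ℝ)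
    (hreg : ContDiffOn ℝ 2 (fun q : ℝ × ℝ × ℝ => H q.1 q.2.1 q.2.2)
      (Icc 0 T ×ˢ (univ : Set ℝ) ×ˢ Ici (0:ℝ)))
    (hper : ∀ t x y, H t (x + 1) y = H t x y)
    (hbdd : ∃ M, ∀ t ∈ Icc (0:ℝ) T, ∀ (x : ℝ), ∀ y ∈ Ici (0:ℝ), |H t x y| ≤ M)
    (hb1c : ContinuousOn (fun q : ℝ × ℝ × ℝ => b₁ q.1 q.2.1 q.2.2)
      (Icc 0 T ×ˢ (univ : Set ℝ) ×ˢ Ici (0:ℝ)))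
    (hb2c : ContinuousOn (fun q : ℝ × ℝ × ℝ => b₂ q.1 q.2.1 q.2.2)
      (Icc 0 T ×ˢ (univ : Set ℝ) ×ˢ Ici (0:ℝ)))
    (hfc : ContinuousOn (fun q : ℝ × ℝ × ℝ => f q.1 q.2.1 q.2.2)
      (Icc 0 T ×ˢ (univ : Set ℝ) ×ˢ Ici (0:ℝ)))
    (hb2bdd : ∃ M, ∀ t ∈ Icc (0:ℝ) T, ∀ (x : ℝ), ∀ y ∈ Ici (0:ℝ), |b₂ t x y / (1 + y)| ≤ M)
    (hfbdd : ∀ t ∈ Icc (0:ℝ) T, ∀ (x : ℝ), ∀ y ∈ Ici (0:ℝ), |f t x y| ≤ lam)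
    (hineq : ∀ t ∈ Icc (0:ℝ) T, ∀ (x : ℝ), ∀ y ∈ Ici (0:ℝ),
      deriv (fun t' => H t' x y) t + b₁ t x y * px (H t) x y + b₂ t x y * py (H t) x y
        - ε ^ 2 * px (px (H t)) x y - py (py (H t)) x y ≤ f t x y * H t x y) :
    ∀ t ∈ Icc (0:ℝ) T,
      sSup {r : ℝ | ∃ x y, 0 ≤ y ∧ r = H t x y}
        ≤ max (Real.exp (lam * t) * Linf (H 0))
            (sSup {r : ℝ | ∃ τ ∈ Icc (0:ℝ) t,
              r = Real.exp (lam * (t - τ)) * LinfT (fun x => H τ x 0)}) := by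
  intro t ht
  set R := max (Real.exp (lam * t) * Linf (H 0))
    (sSup {r : ℝ | ∃ τ ∈ Icc (0:ℝ) t,
      r = Real.exp (lam * (t - τ)) * LinfT (fun x => H τ x 0)}) with hR
  obtain ⟨M, hM⟩ := id hbdd
  have hT0 : (0:ℝ) ∈ Icc 0 T := ⟨le_rfl, hT.le⟩
  have hlam : 0 ≤ lam := (abs_nonneg _).trans (hfbdd 0 hT0 0 0 (mem_Ici.2 le_rfl))
  have hM0 : 0 ≤ M := (abs_nonneg _).trans (hM 0 hT0 0 0 (mem_Ici.2 le_rfl))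
  have hinit : ∀ x y, 0 ≤ y → |H 0 x y| ≤ Linf (H 0) := fun x y hy =>
    le_csSup ⟨M, by rintro _ ⟨x, y, hy, rfl⟩; exact hM 0 hT0 x y hy⟩ ⟨x, y, hy, rfl⟩
  have hsubT : ∀ τ ∈ Icc 0 t, τ ∈ Icc 0 T := fun τ hτ => ⟨hτ.1, hτ.2.trans ht.2⟩
  have htrace : ∀ τ ∈ Icc 0 t, ∀ x, |H τ x 0| ≤ LinfT (fun x => H τ x 0) := fun τ hτ x =>
    le_csSup ⟨M, by rintro _ ⟨x, rfl⟩; exact hM τ (hsubT τ hτ) x 0 (mem_Ici.2 le_rfl)⟩ ⟨x, rfl⟩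
  have htraceM : ∀ τ ∈ Icc 0 t, LinfT (fun x => H τ x 0) ≤ M := fun τ hτ =>
    csSup_le ⟨_, 0, rfl⟩
      (by rintro _ ⟨x, rfl⟩; exact hM τ (hsubT τ hτ) x 0 (mem_Ici.2 le_rfl))
  have hbdryR : ∀ τ ∈ Icc 0 t, exp (lam * (t - τ)) * LinfT (fun x => H τ x 0) ≤ R := by
    intro τ hτ
    refine (le_csSup (s := {r : ℝ | ∃ τ ∈ Icc (0:ℝ) t,
      r = exp (lam * (t - τ)) * LinfT (fun x => H τ x 0)}) ?_ ⟨τ, hτ, rfl⟩).trans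
      (le_max_right _ _)
    refine ⟨exp (lam * t) * M, ?_⟩
    rintro _ ⟨τ, hτ, rfl⟩
    gcongr
    · exact (abs_nonneg _).trans (htrace τ hτ 0)
    · linarith [hτ.1]
    · exact htraceM τ hτ
  have hinitR : exp (lam * t) * Linf (H 0) ≤ R := le_max_left _ _
  have hR0 : 0 ≤ R := le_trans
    (mul_nonneg (exp_pos _).le ((abs_nonneg _).trans (hinit 0 0 le_rfl))) hinitR
  have hbefore : ∀ S ∈ Ico 0 t, ∀ x y, 0 ≤ y →
      H S x y ≤ exp (lam * S) * (exp (-(lam * t)) * R) := by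
    intro S hS x y hy
    refine le_exp_mul_of_parabolic_boundary_le hreg hper hbdd hb2bdd hfbdd hineq
      (hS.2.trans_le ht.2) (by positivity) ?_ ?_ ⟨hS.1, le_rfl⟩ x y hy
    · intro x y hy
      have h1 := mul_le_mul_of_nonneg_left hinitR (exp_pos (-(lam * t))).le
      rw [← mul_assoc, ← exp_add, neg_add_cancel, exp_zero, one_mul] at h1
      exact (le_abs_self _).trans ((hinit x y hy).trans h1)
    · intro τ hτ x
      have hτt : τ ∈ Icc 0 t := ⟨hτ.1, hτ.2.trans hS.2.le⟩
      have h1 := mul_le_mul_of_nonneg_left (hbdryR τ hτt) (exp_pos (-(lam * (t - τ)))).le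
      rw [← mul_assoc, ← exp_add, neg_add_cancel, exp_zero, one_mul] at h1
      rw [← mul_assoc, ← exp_add, show lam * τ + -(lam * t) = -(lam * (t - τ)) by ring]
      exact (le_abs_self _).trans ((htrace τ hτt x).trans h1)
  refine csSup_le ⟨_, 0, 0, le_rfl, rfl⟩ ?_
  rintro _ ⟨x, y, hy, rfl⟩
  rcases ht.1.eq_or_lt with h0 | h0
  · have h1 := (le_abs_self _).trans ((hinit x y hy).trans (by simpa [← h0] using hinitR))
    rwa [h0] at h1
  · have hcont : ContinuousOn (fun s => H s x y) (Icc 0 T) :=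
      hreg.continuousOn.comp (f := fun s : ℝ => (s, x, y)) (by fun_prop)
        fun s hs => ⟨hs, mem_univ _, hy⟩
    have hlim : Tendsto (fun s => H s x y) (𝓝[Ico 0 t] t) (𝓝 (H t x y)) :=
      (hcont t ht).mono_left
        (nhdsWithin_mono _ fun s hs => hsubT s (Ico_subset_Icc_self hs))
    have hlim' : Tendsto (fun s => exp (lam * s) * (exp (-(lam * t)) * R))
        (𝓝[Ico 0 t] t) (𝓝 R) := by
      have hc : Continuous (fun s => exp (lam * s) * (exp (-(lam * t)) * R)) := by fun_prop
      have h1 := (hc.tendsto t).mono_left (nhdsWithin_le_nhds (s := Ico 0 t))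
      rwa [← mul_assoc, ← exp_add, add_neg_cancel, exp_zero, one_mul] at h1
    have : (𝓝[Ico 0 t] t).NeBot := by
      rw [nhdsWithin_Ico_eq_nhdsLT h0]
      infer_instance
    refine le_of_tendsto_of_tendsto hlim hlim' ?_
    filter_upwards [self_mem_nhdsWithin] with s hs using hbefore s hs x y hy
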